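/- Let G be a graph with maximum average degree mad(G), and let a, b, q, r be positive integers with a ≥ b, a/b ≥ (1/2)·mad(G), q ≥ 2, and v(G) ≥ 6·r·a·q^{ar+1}·Δ(G)^{3r}. Then stww(G) ≤ max{ r^{2b}·a^b·q^{ar − b(r−1) + 1}, (3/q^{ar})·v(G)·Δ(G) }. -/

import Mathlib

noncomputable section

namespace TwwPaper

open Finset

variable {V : Type*}

/-- The number of edges of `G` with both endpoints in `X`. -/
def edgesIn (G : SimpleGraph V) (X : Finset V) : ℕ :=
  Nat.card {e : Sym2 V // e ∈ G.edgeSet ∧ ∀ v ∈ e, v ∈ X}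

/-- The number of edges of `G`. -/
def edgeCount (G : SimpleGraph V) : ℕ := Nat.card G.edgeSet

/-- The maximum average degree of `G`: the maximum over nonempty vertex subsets `X`
of `2 e(G[X]) / |X|`. -/
def mad [Fintype V] (G : SimpleGraph V) : ℝ :=
  ⨆ X : {X : Finset V // X.Nonempty}, (2 * edgesIn G X.1 : ℝ) / X.1.card

/-- The degree of a vertex. -/
def deg (G : SimpleGraph V) (v : V) : ℕ := Nat.card (G.neighborSet v)

/-- The maximum degree `Δ(G)`. -/
def maxDeg [Fintype V] (G : SimpleGraph V) : ℕ := univ.sup (deg G)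

/-- `G` is `d`-regular. -/
def IsReg (G : SimpleGraph V) (d : ℕ) : Prop := ∀ v, deg G v = d

/-- `G` admits an orientation with maximum outdegree at most one:
an assignment of a tail (source) vertex to each edge, no vertex being
the tail of two distinct edges. -/
def HasOrientationOutdegLEOne (G : SimpleGraph V) : Prop :=
  ∃ f : G.edgeSet → V, (∀ e : G.edgeSet, f e ∈ (e : Sym2 V)) ∧ Function.Injective f

/-- Two lists (sequences) of the same length `r` are close if they contain a common
subsequence of length `r - 1`, obtained by deleting one entry from each. -/
def Close {S : Type*} (L M : List S) : Prop :=
  ∃ i < L.length, ∃ j < M.length, L.eraseIdx i = M.eraseIdx j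

section Partitions

variable [Fintype V] [DecidableEq V]

/-- `Q` is obtained from `P` by merging the two distinct parts `A` and `B`. -/
def IsMergeStep (P Q : Finpartition (univ : Finset V)) : Prop :=
  ∃ A ∈ P.parts, ∃ B ∈ P.parts, A ≠ B ∧
    Q.parts = insert (A ∪ B) ((P.parts.erase A).erase B)

/-- Degree of the part `A` in the quotient graph `G / P`. -/
def quotDeg (G : SimpleGraph V) (P : Finpartition (univ : Finset V)) (A : Finset V) : ℕ :=
  Nat.card {B : Finset V // B ∈ P.parts ∧ B ≠ A ∧ ∃ u ∈ A, ∃ v ∈ B, G.Adj u v}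

/-- Red degree of the part `A` with respect to the partition `P`: the number of other
parts `B` which are neither fully adjacent nor fully non-adjacent to `A`. -/
def redDeg (G : SimpleGraph V) (P : Finpartition (univ : Finset V)) (A : Finset V) : ℕ :=
  Nat.card {B : Finset V // B ∈ P.parts ∧ B ≠ A ∧ (∃ u ∈ A, ∃ v ∈ B, G.Adj u v) ∧
    ¬ (∀ u ∈ A, ∀ v ∈ B, G.Adj u v)}

/-- There is a sequence of partitions of `V(G)`, starting at the discrete partition,
ending with at most one part, each obtained from the previous one by merging two parts,
such that every part of every intermediate partition has `degFn`-degree at most `w`. -/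
def SeqOK (G : SimpleGraph V)
    (degFn : SimpleGraph V → Finpartition (univ : Finset V) → Finset V → ℕ) (w : ℕ) : Prop :=
  ∃ n : ℕ, ∃ P : Fin (n + 1) → Finpartition (univ : Finset V),
    (∀ A ∈ (P 0).parts, A.card = 1) ∧
    (P (Fin.last n)).parts.card ≤ 1 ∧
    (∀ i : Fin n, IsMergeStep (P i.castSucc) (P i.succ)) ∧
    (∀ i, ∀ A ∈ (P i).parts, degFn G (P i) A ≤ w)

/-- The sparse twin-width of `G`: the least `w` such that `G` can be contracted to a
single vertex by iterated pairwise identifications with all intermediate (quotient)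
graphs of maximum degree at most `w`. -/
def stww (G : SimpleGraph V) : ℕ := sInf {w | SeqOK G quotDeg w}

/-- The twin-width of `G`, via contraction sequences minimizing the maximum red degree. -/
def tww (G : SimpleGraph V) : ℕ := sInf {w | SeqOK G redDeg w}

/-- The quotient graph `G / P`: parts of `P` are adjacent iff some edge of `G` joins them. -/
def quotGraph (G : SimpleGraph V) (P : Finpartition (univ : Finset V)) :
    SimpleGraph {A : Finset V // A ∈ P.parts} :=
  SimpleGraph.fromRel (fun A B => ∃ u ∈ A.1, ∃ v ∈ B.1, G.Adj u v)

end Partitions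

/-- A graph is `w`-degenerate if every nonempty (induced) subgraph has a vertex of
degree at most `w` in it. -/
def Degenerate {W : Type*} (w : ℕ) (H : SimpleGraph W) : Prop :=
  ∀ s : Finset W, s.Nonempty → ∃ a ∈ s, Nat.card {b : W // b ∈ s ∧ H.Adj a b} ≤ w

/-- The graph `Π(r₁,…,r_a; b, q)`: vertices are tuples `(v₁,…,v_a)` with `vᵢ ∈ [q]^{rᵢ}`,
two tuples being adjacent iff (they are distinct and) at least `b` coordinates are
pairwise equal or close. -/
def PiGraph (a b q : ℕ) (rfn : Fin a → ℕ) : SimpleGraph (∀ i : Fin a, Fin (rfn i) → Fin q) :=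
  SimpleGraph.fromRel (fun u v => ∃ I : Finset (Fin a), I.card = b ∧
    ∀ i ∈ I, u i = v i ∨ Close (List.ofFn (u i)) (List.ofFn (v i)))

open Relation

lemma exists_perm_decomposition {ι : Type*} [Fintype ι] [DecidableEq ι] (a : ℕ)
    (M : ι → ι → ℕ) (hrow : ∀ i, ∑ j, M i j = a) (hcol : ∀ j, ∑ i, M i j = a) :
    ∃ σ : Fin a → ι → ι, (∀ c, Function.Injective (σ c)) ∧
      ∀ i j, #{c | σ c i = j} = M i j := by
  induction a generalizing M with
  | zero =>
    refine ⟨fun c => c.elim0, fun c => c.elim0, fun i j => ?_⟩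
    have := hrow i
    simp only [Finset.sum_eq_zero_iff] at this
    simp [this j (mem_univ j)]
  | succ a ih =>
    have hall : ∀ S : Finset ι, #S ≤ #(S.biUnion fun i => univ.filter fun j => 0 < M i j) := by
      intro S
      set T := S.biUnion fun i => univ.filter fun j => 0 < M i j with hT
      have h1 : ∑ i ∈ S, ∑ j, M i j = ∑ i ∈ S, ∑ j ∈ T, M i j := by
        refine Finset.sum_congr rfl fun i hi => ?_
        symm
        refine Finset.sum_subset (subset_univ _) fun j _ hj => ?_
        by_contra h
        exact hj (mem_biUnion.2 ⟨i, hi, by simp; omega⟩)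
      have h2 : ∑ i ∈ S, ∑ j ∈ T, M i j ≤ ∑ j ∈ T, ∑ i, M i j := by
        rw [Finset.sum_comm]
        exact Finset.sum_le_sum fun j _ =>
          Finset.sum_le_sum_of_subset (subset_univ _)
      rw [← h1] at h2
      simp only [hrow, hcol, sum_const, smul_eq_mul] at h2
      exact Nat.le_of_mul_le_mul_right h2 (Nat.succ_pos a)
    obtain ⟨τ, hτ, hτM⟩ := (Finset.all_card_le_biUnion_card_iff_exists_injective _).1 hall
    have hpos : ∀ i, 0 < M i (τ i) := fun i => by simpa using hτM i
    have hbij : Function.Bijective τ := Finite.injective_iff_bijective.1 hτ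
    have key : ∀ i j, (M i j - if τ i = j then 1 else 0) + (if τ i = j then 1 else 0) = M i j := by
      intro i j
      split_ifs with h
      · subst h; have := hpos i; omega
      · omega
    obtain ⟨σ, hσ, hσM⟩ := ih (fun i j => M i j - if τ i = j then 1 else 0)
      (fun i => by
        have h := hrow i
        rw [← Finset.sum_congr rfl fun j _ => key i j, Finset.sum_add_distrib] at h
        simpa using h)
      (fun j => by
        have h := hcol j
        rw [← Finset.sum_congr rfl fun i _ => key i j, Finset.sum_add_distrib] at h
        obtain ⟨i₀, rfl⟩ := hbij.2 j
        simpa [hτ.eq_iff] using h)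
    refine ⟨Fin.cons τ σ, fun c => ?_, fun i j => ?_⟩
    · refine Fin.cases ?_ (fun c => ?_) c
      · simpa using hτ
      · simpa using hσ c
    · rw [Fin.card_filter_univ_succ]
      have := key i j
      have h2 := hσM i j
      simp only [Fin.cons_zero, Fin.cons_succ] at *
      split_ifs at * <;> omega

lemma edgesIn_le [Fintype V] (G : SimpleGraph V) {a b : ℕ} (hb : 0 < b)
    (hmad : mad G / 2 ≤ (a : ℝ) / b) (X : Finset V) : b * edgesIn G X ≤ a * #X := by
  rcases X.eq_empty_or_nonempty with rfl | hX
  · have : edgesIn G (∅ : Finset V) = 0 := by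
      unfold edgesIn
      have : IsEmpty {e : Sym2 V // e ∈ G.edgeSet ∧ ∀ v ∈ e, v ∈ (∅ : Finset V)} :=
        ⟨fun ⟨e, _, h⟩ => by induction e with | _ x y => simpa using h x (by simp)⟩
      exact Nat.card_of_isEmpty
    simp [this]
  · have h1 : (2 * edgesIn G X : ℝ) / #X ≤ mad G :=
      le_ciSup (f := fun X : {X : Finset V // X.Nonempty} => (2 * edgesIn G X.1 : ℝ) / #X.1)
        (Set.finite_range _).bddAbove ⟨X, hX⟩
    have hX' : (0 : ℝ) < #X := by exact_mod_cast hX.card_pos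
    have hb' : (0 : ℝ) < b := by exact_mod_cast hb
    have h2 : (edgesIn G X : ℝ) / #X ≤ a / b := by
      refine le_trans ?_ hmad
      rw [mul_div_assoc] at h1
      linarith
    rw [div_le_div_iff₀ hX' hb'] at h2
    have : edgesIn G X * b ≤ a * #X := by exact_mod_cast h2
    linarith

lemma exists_fractional_orientation [Fintype V] [DecidableEq V] (G : SimpleGraph V)
    [Fintype G.edgeSet] {a b : ℕ} (hb : 0 < b) (hmad : mad G / 2 ≤ (a : ℝ) / b) :
    ∃ M : G.edgeSet → V → ℕ, (∀ e, ∑ v, M e v = b) ∧ (∀ v, ∑ e, M e v ≤ a) ∧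
      ∀ e v, 0 < M e v → v ∈ (e : Sym2 V) := by
  classical
  have hall : ∀ S : Finset (G.edgeSet × Fin b),
      #S ≤ #(S.biUnion fun x => (univ.filter fun v => v ∈ (x.1 : Sym2 V)) ×ˢ
        (univ : Finset (Fin a))) := by
    intro S
    set X : Finset V := (S.image Prod.fst).biUnion fun e => univ.filter fun v => v ∈ (e : Sym2 V)
      with hX
    have h1 : (S.biUnion fun x => (univ.filter fun v => v ∈ (x.1 : Sym2 V)) ×ˢ
        (univ : Finset (Fin a))) = X ×ˢ univ := by
      ext ⟨v, c⟩
      simp [hX]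
    have h2 : #S ≤ #(S.image Prod.fst) * b := by
      have : S ⊆ (S.image Prod.fst) ×ˢ (univ : Finset (Fin b)) := fun x hx =>
        mem_product.2 ⟨mem_image_of_mem _ hx, mem_univ _⟩
      simpa using card_le_card this
    have h3 : #(S.image Prod.fst) ≤ edgesIn G X := by
      unfold edgesIn
      rw [← Nat.card_eq_finsetCard]
      refine Nat.card_le_card_of_injective
        (fun e => ⟨e.1.1, e.1.2, fun v hv => mem_biUnion.2 ⟨e.1, e.2, by simpa using hv⟩⟩) ?_
      intro e e' h
      exact Subtype.ext (Subtype.ext (by simpa using h))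
    have h4 := edgesIn_le G hb hmad X
    rw [h1, card_product, card_univ, Fintype.card_fin]
    nlinarith
  obtain ⟨g, hg, hgm⟩ := (Finset.all_card_le_biUnion_card_iff_exists_injective _).1 hall
  refine ⟨fun e v => #{k | (g (e, k)).1 = v}, fun e => ?_, fun v => ?_, fun e v h => ?_⟩
  · rw [← Finset.card_eq_sum_card_fiberwise (fun _ _ => mem_coe.2 (mem_univ _))]
    simp
  · have : ∑ e, #{k : Fin b | (g (e, k)).1 = v} = #{x : G.edgeSet × Fin b | (g x).1 = v} := by
      rw [← card_sigma]
      refine card_bij (fun x _ => (x.1, x.2)) ?_ ?_ ?_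
      · simp
      · rintro ⟨e, k⟩ _ ⟨e', k'⟩ _ h
        simp only [Prod.mk.injEq] at h
        obtain ⟨rfl, rfl⟩ := h
        rfl
      · rintro ⟨e, k⟩ h
        exact ⟨⟨e, k⟩, by simpa using h, rfl⟩
    rw [this]
    calc _ ≤ #(univ : Finset (Fin a)) := card_le_card_of_injOn (fun x => (g x).2)
            (fun _ _ => mem_coe.2 (mem_univ _)) (fun x hx y hy h => hg (Prod.ext (by
              simp only [coe_filter, mem_univ, true_and, Set.mem_ofPred_eq] at hx hy
              rw [hx, hy]) h))
      _ = a := by simp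
  · obtain ⟨k, hk⟩ := card_pos.1 h
    have := hgm (e, k)
    simp only [mem_filter, mem_univ, true_and, mem_product, and_true] at hk this
    exact hk ▸ this

lemma exists_covering_functions [Fintype V] (G : SimpleGraph V) {a b : ℕ} (hb : 0 < b)
    (hba : b ≤ a) (hmad : mad G / 2 ≤ (a : ℝ) / b) :
    ∃ f : Fin a → V → V, (∀ c v, f c v = v ∨ G.Adj v (f c v)) ∧
      ∀ u v, G.Adj u v → ∃ I : Finset (Fin a), #I = b ∧ ∀ c ∈ I, f c u = v ∨ f c v = u := by
  classical
  obtain ⟨M, hM1, hM2, hM3⟩ := exists_fractional_orientation G hb hmad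
  let N : G.edgeSet ⊕ V → G.edgeSet ⊕ V → ℕ := fun x y =>
    match x, y with
    | .inl e, .inl e' => if e = e' then a - b else 0
    | .inl e, .inr v => M e v
    | .inr v, .inl e => M e v
    | .inr v, .inr v' => if v = v' then a - ∑ e, M e v else 0
  have hsymm : ∀ x y, N x y = N y x := by
    rintro (e | v) (e' | v')
    · simp only [N, eq_comm]
    · rfl
    · rfl
    · simp only [N]
      by_cases h : v = v'
      · subst h; rfl
      · simp [h, Ne.symm h]
  have hrow : ∀ x, ∑ y, N x y = a := by
    rintro (e | v)
    · simp [N, Fintype.sum_sum_type, hM1, hba]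
    · simp [N, Fintype.sum_sum_type, hM2]
  obtain ⟨σ, hσ, hσN⟩ := exists_perm_decomposition a N hrow
    (fun y => (Finset.sum_congr rfl fun x _ => hsymm x y).trans (hrow y))
  have hNpos : ∀ c x, 0 < N x (σ c x) := fun c x => by
    rw [← hσN]; exact card_pos.2 ⟨c, by simp⟩
  have hmem : ∀ c e v, σ c (.inl e) = .inr v → v ∈ (e : Sym2 V) := fun c e v h => by
    have := hNpos c (.inl e)
    rw [h] at this
    exact hM3 _ _ this
  have hex : ∀ c v, ∃ w, (w = v ∨ G.Adj v w) ∧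
      ∀ e : G.edgeSet, σ c (.inl e) = .inr v → (e : Sym2 V) = s(v, w) := by
    intro c v
    by_cases h : ∃ e : G.edgeSet, σ c (.inl e) = .inr v
    · obtain ⟨e, he⟩ := h
      obtain ⟨w, hw⟩ := hmem c e v he
      refine ⟨w, Or.inr ?_, fun e' he' => ?_⟩
      · have := e.2
        rw [hw] at this
        exact this
      · have := hσ c (he'.trans he.symm)
        rw [Sum.inl.inj this, hw]
    · exact ⟨v, Or.inl rfl, fun e he => (h ⟨e, he⟩).elim⟩
  choose f hf1 hf2 using hex
  refine ⟨f, hf1, fun u v huv => ?_⟩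
  let e : G.edgeSet := ⟨s(u, v), huv⟩
  refine ⟨univ.filter fun c => ∃ w, σ c (.inl e) = .inr w, ?_, fun c hc => ?_⟩
  · have h : (univ.filter fun c => ∃ w, σ c (.inl e) = .inr w) =
        univ.biUnion fun w => univ.filter fun c => σ c (.inl e) = .inr w := by
      ext c; simp
    rw [h, card_biUnion, ← hM1 e]
    · exact Finset.sum_congr rfl fun w _ => hσN (.inl e) (.inr w)
    · intro w _ w' _ hww'
      rw [Function.onFun, Finset.disjoint_left]
      intro c hc hc'
      simp only [mem_filter, mem_univ, true_and] at hc hc'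
      exact hww' (Sum.inr.inj (hc.symm.trans hc'))
  · obtain ⟨w, hw⟩ := (mem_filter.1 hc).2
    have h1 := hf2 c w e hw
    have h2 := hmem c e w hw
    change s(u, v) = s(w, f c w) at h1
    change w ∈ s(u, v) at h2
    rcases Sym2.mem_iff.1 h2 with rfl | rfl
    · left; exact (Sym2.congr_right.1 h1).symm
    · right; rw [Sym2.eq_swap] at h1; exact (Sym2.congr_right.1 h1).symm

section Orbits

variable {f : V → V}

lemma exists_iterate_repeat [Finite V] (f : V → V) (v : V) :
    ∃ k, ∃ j < k, f^[k] v = f^[j] v := by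
  obtain ⟨i, j, hij, h⟩ := Finite.exists_ne_map_eq_of_infinite (fun k : ℕ => f^[k] v)
  rcases lt_or_gt_of_ne hij with h' | h'
  · exact ⟨j, i, h', h.symm⟩
  · exact ⟨i, j, h', h⟩

/-- The number of distinct points in the forward orbit of `v` under `f`. -/
def orbitLen [Finite V] (f : V → V) (v : V) : ℕ :=
  open Classical in Nat.find (exists_iterate_repeat f v)

/-- The points visited infinitely often by the forward orbit of `v` under `f`. -/
def limitSet (f : V → V) (v : V) : Set V := {x | ∀ N, ∃ k ≥ N, f^[k] v = x}

/-- The forward orbit of `v` without repetitions, continued by auxiliary symbols that depend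
only on the cycle the orbit ends in. -/
def orbitSeq [Finite V] (f : V → V) (r : ℕ) [NeZero r] (v : V) (k : ℕ) : V ⊕ (Set V × Fin r) :=
  if k < orbitLen f v then .inl (f^[k] v) else .inr (limitSet f v, Fin.ofNat r (k - orbitLen f v))

lemma limitSet_apply (f : V → V) (v : V) : limitSet f (f v) = limitSet f v := by
  ext x
  constructor
  · intro h N
    obtain ⟨k, hk, hx⟩ := h N
    exact ⟨k + 1, by omega, hx⟩
  · intro h N
    obtain ⟨k, hk, hx⟩ := h (N + 1)
    obtain ⟨k, rfl⟩ : ∃ k', k = k' + 1 := ⟨k - 1, by omega⟩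
    exact ⟨k, by omega, hx⟩

variable [Finite V]

lemma orbitLen_spec (f : V → V) (v : V) :
    ∃ j < orbitLen f v, f^[orbitLen f v] v = f^[j] v := by
  classical
  unfold orbitLen
  convert Nat.find_spec (exists_iterate_repeat f v)

lemma orbitLen_le {v : V} {k j : ℕ} (hj : j < k) (h : f^[k] v = f^[j] v) :
    orbitLen f v ≤ k := by
  classical
  exact Nat.find_min' (exists_iterate_repeat f v) ⟨j, hj, h⟩

lemma iterate_inj_of_lt_orbitLen {v : V} {k j : ℕ} (hk : k < orbitLen f v)
    (hj : j < orbitLen f v) (h : f^[k] v = f^[j] v) : k = j := by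
  rcases lt_trichotomy k j with h' | h' | h'
  · have := orbitLen_le h' h.symm; omega
  · exact h'
  · have := orbitLen_le h' h; omega

lemma exists_lt_orbitLen_iterate_eq (f : V → V) (v : V) (k : ℕ) :
    ∃ l < orbitLen f v, f^[k] v = f^[l] v := by
  induction k with
  | zero =>
    obtain ⟨j, hj, -⟩ := orbitLen_spec f v
    exact ⟨0, by omega, rfl⟩
  | succ k ih =>
    obtain ⟨l, hl, h⟩ := ih
    rcases Nat.lt_or_ge (l + 1) (orbitLen f v) with h' | h'
    · exact ⟨l + 1, h', by rw [Function.iterate_succ_apply', h, Function.iterate_succ_apply']⟩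
    · obtain ⟨j, hj, hj'⟩ := orbitLen_spec f v
      refine ⟨j, hj, ?_⟩
      rw [← hj', show orbitLen f v = l + 1 by omega, Function.iterate_succ_apply', h,
        Function.iterate_succ_apply']

lemma limitSet_nonempty (f : V → V) (v : V) : (limitSet f v).Nonempty := by
  obtain ⟨x, hx⟩ := Finite.exists_infinite_fiber (fun k : ℕ => f^[k] v)
  refine ⟨x, fun N => ?_⟩
  obtain ⟨k, hk, hN⟩ := (Set.infinite_coe_iff.1 hx).exists_gt N
  exact ⟨k, hN.le, hk⟩

lemma orbitLen_apply (f : V → V) (v : V) :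
    orbitLen f v = orbitLen f (f v) + 1 ∨
      orbitLen f (f v) = orbitLen f v ∧ f^[orbitLen f v] v = v := by
  obtain ⟨j, hj, h⟩ := orbitLen_spec f v
  obtain ⟨i, hi, h'⟩ := orbitLen_spec f (f v)
  have h1 : orbitLen f v ≤ orbitLen f (f v) + 1 := orbitLen_le (Nat.succ_lt_succ hi) h'
  rcases Nat.eq_zero_or_pos j with rfl | hj0
  · right
    refine ⟨le_antisymm (orbitLen_le hj ?_) ?_, h⟩
    · rw [← Function.iterate_succ_apply, Function.iterate_succ_apply', h]; rfl
    · by_contra hlt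
      have heq : orbitLen f v = orbitLen f (f v) + 1 := by omega
      have : f^[i + 1] v = f^[0] v := by
        rw [← h, heq]; exact h'.symm
      have := iterate_inj_of_lt_orbitLen (by omega) hj this
      omega
  · left
    obtain ⟨m, hm⟩ : ∃ m, orbitLen f v = m + 1 := ⟨orbitLen f v - 1, by omega⟩
    obtain ⟨j, rfl⟩ : ∃ j', j = j' + 1 := ⟨j - 1, by omega⟩
    rw [hm] at h
    have : orbitLen f (f v) ≤ m := orbitLen_le (j := j) (by omega) h
    omega

lemma orbitSeq_injOn {r : ℕ} [NeZero r] {v : V} {k l : ℕ} (hk : k < r) (hl : l < r)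
    (h : orbitSeq f r v k = orbitSeq f r v l) : k = l := by
  unfold orbitSeq at h
  split_ifs at h with h1 h2 h2
  · exact iterate_inj_of_lt_orbitLen h1 h2 (Sum.inl.inj h)
  · have h3 := congrArg Fin.val (Prod.ext_iff.1 (Sum.inr.inj h)).2
    simp only [Fin.val_ofNat] at h3
    rw [Nat.mod_eq_of_lt (by omega), Nat.mod_eq_of_lt (by omega)] at h3
    omega

lemma exists_iterate_eq_of_orbitSeq_eq {r : ℕ} [NeZero r] {u v : V} {k l : ℕ} (hk : k < r)
    (hl : l < r) (h : orbitSeq f r u k = orbitSeq f r v l) :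
    ∃ k' < r, ∃ l' < r, f^[k'] u = f^[l'] v := by
  unfold orbitSeq at h
  split_ifs at h with h1 h2 h2
  · exact ⟨k, hk, l, hl, Sum.inl.inj h⟩
  · have h3 : limitSet f u = limitSet f v := (Prod.ext_iff.1 (Sum.inr.inj h)).1
    obtain ⟨x, hx⟩ := limitSet_nonempty f u
    obtain ⟨k₀, -, hk₀⟩ := hx 0
    obtain ⟨l₀, -, hl₀⟩ := (h3 ▸ hx : x ∈ limitSet f v) 0
    obtain ⟨k', hk', e⟩ := exists_lt_orbitLen_iterate_eq f u k₀
    obtain ⟨l', hl', e'⟩ := exists_lt_orbitLen_iterate_eq f v l₀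
    exact ⟨k', by omega, l', by omega, by rw [← e, ← e', hk₀, hl₀]⟩

lemma orbitSeq_apply {r : ℕ} [NeZero r] (f : V → V) (v : V) {ℓ : ℕ} (hℓ : 0 < ℓ) :
    ∃ j < ℓ, (∀ k < j, orbitSeq f r (f v) k = orbitSeq f r v (k + 1)) ∧
      ∀ k, j < k → k < ℓ → orbitSeq f r (f v) k = orbitSeq f r v k := by
  rcases orbitLen_apply f v with h | ⟨h, hper⟩
  · refine ⟨ℓ - 1, by omega, fun k _ => ?_, fun k _ _ => by omega⟩
    simp only [orbitSeq, h, add_lt_add_iff_right, limitSet_apply, Nat.add_sub_add_right]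
    rfl
  · obtain ⟨j, hj, -⟩ := orbitLen_spec f v
    refine ⟨min (orbitLen f v - 1) (ℓ - 1), by omega, fun k hk => ?_, fun k hk hk' => ?_⟩
    · unfold orbitSeq
      rw [if_pos (by omega), if_pos (by omega)]
      rfl
    · unfold orbitSeq
      rw [if_neg (by omega), if_neg (by omega), h, limitSet_apply]

lemma close_map_orbitSeq {S : Type*} {r : ℕ} [NeZero r] (f : V → V) (v : V)
    (ω : V ⊕ (Set V × Fin r) → S) {ℓ : ℕ} (hℓ : 0 < ℓ) :
    Close ((List.range ℓ).map fun k => ω (orbitSeq f r v k))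
      ((List.range ℓ).map fun k => ω (orbitSeq f r (f v) k)) := by
  obtain ⟨j, hj, h1, h2⟩ := orbitSeq_apply (r := r) f v hℓ
  refine ⟨0, by simpa, j, by simpa, ?_⟩
  refine List.ext_getElem (by simp [List.length_eraseIdx, hj]) fun k hk hk' => ?_
  have hk'' : k < ℓ - 1 := by simpa using hk
  simp only [List.getElem_eraseIdx, List.getElem_map, List.getElem_range, not_lt_zero, dite_false]
  split_ifs with hkj
  · rw [h1 k hkj]
  · rw [h2 (k + 1) (by omega) (by omega)]

end Orbits

lemma Close.symm {S : Type*} {L M : List S} (h : Close L M) : Close M L := by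
  obtain ⟨i, hi, j, hj, h⟩ := h
  exact ⟨j, hj, i, hi, h.symm⟩

/-- The lists which are close to `L`, or empty if `L` is empty. -/
def closeLists {q : ℕ} (r : ℕ) (L : List (Fin q)) : Finset (List (Fin q)) :=
  if L = [] then {[]} else
    (range r ×ˢ range r ×ˢ (univ : Finset (Fin q))).image
      fun p => (L.eraseIdx p.1).insertIdx p.2.1 p.2.2

lemma card_closeLists_le {q r : ℕ} (hq : 0 < q) (hr : 0 < r) (L : List (Fin q)) :
    #(closeLists r L) ≤ r ^ 2 * q := by
  unfold closeLists
  split_ifs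
  · simpa using Nat.succ_le_of_lt (show 0 < r ^ 2 * q by positivity)
  · refine card_image_le.trans ?_
    simp only [card_product, card_range, card_univ, Fintype.card_fin]
    exact le_of_eq (by ring)

lemma Close.mem_closeLists {q r : ℕ} {L M : List (Fin q)} (h : Close L M) (hL : L.length ≤ r)
    (hM : M.length ≤ r) : M ∈ closeLists r L := by
  obtain ⟨i, hi, j, hj, h⟩ := h
  have : L ≠ [] := by rintro rfl; simp at hi
  rw [closeLists, if_neg this, mem_image]
  refine ⟨(i, j, M[j]), by simp; omega, ?_⟩
  simp only [h]
  apply List.ext_getElem?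
  intro k
  simp only [List.getElem?_insertIdx, List.getElem?_eraseIdx, List.length_eraseIdx, hj, if_true]
  split_ifs with h1 h2 h3 h4
  all_goals grind

section RandomColoring

variable {X J : Type*} [Fintype X] [DecidableEq X] [Fintype J] [DecidableEq J] {q : ℕ}

lemma card_prescribed_mul_le (ρ : J → X) (hρ : Function.Injective ρ) (x : J → Fin q) :
    #{ω : X → Fin q | ∀ j, ω (ρ j) = x j} * q ^ Fintype.card J ≤ q ^ Fintype.card X := by
  have h := card_le_card_of_injOn
    (s := ({ω : X → Fin q | ∀ j, ω (ρ j) = x j} : Finset _) ×ˢ (univ : Finset (J → Fin q)))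
    (t := (univ : Finset (X → Fin q))) (fun p => Function.extend ρ p.2 p.1)
    (fun _ _ => mem_coe.2 (mem_univ _)) (by
      rintro ⟨ω, y⟩ h ⟨ω', y'⟩ h' heq
      simp only [coe_product, coe_filter, mem_univ, true_and, coe_univ, Set.mem_prod,
        Set.mem_ofPred_eq, Set.mem_univ, and_true] at h h' heq
      refine Prod.ext (funext fun z => ?_) (funext fun j => ?_)
      · by_cases hz : ∃ j, ρ j = z
        · obtain ⟨j, rfl⟩ := hz
          exact (h j).trans (h' j).symm
        · have := congrFun heq z
          rwa [Function.extend_apply' _ _ _ hz, Function.extend_apply' _ _ _ hz] at this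
      · have := congrFun heq (ρ j)
        rwa [hρ.extend_apply, hρ.extend_apply] at this)
  simpa using h

lemma sum_prod_one_add_le [DecidableEq V] (hq : 0 < q) (ρ : V → J → X) (C : Finset V)
    (hinj : ∀ v, Function.Injective (ρ v))
    (hdisj : ∀ u ∈ C, ∀ v ∈ C, u ≠ v → ∀ i j, ρ u i ≠ ρ v j) (x : J → Fin q) {s : ℝ}
    (hs : 0 ≤ s) :
    ∑ ω : X → Fin q, ∏ v ∈ C, (1 + if ∀ j, ω (ρ v j) = x j then s else 0) ≤
      (q : ℝ) ^ Fintype.card X * (1 + s / (q : ℝ) ^ Fintype.card J) ^ #C := by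
  have hq' : (0 : ℝ) < q := by exact_mod_cast hq
  have hC : (1 + s / (q : ℝ) ^ Fintype.card J) ^ #C =
      ∏ v ∈ C, (1 + s / (q : ℝ) ^ Fintype.card J) := by rw [prod_const]
  rw [hC, Finset.prod_one_add, Finset.mul_sum]
  simp only [Finset.prod_one_add]
  rw [Finset.sum_comm]
  refine Finset.sum_le_sum fun T hT => ?_
  rw [mem_powerset] at hT
  have h1 : ∀ ω : X → Fin q, (∏ v ∈ T, if ∀ j, ω (ρ v j) = x j then s else 0) =
      if ∀ p : T × J, ω (ρ p.1 p.2) = x p.2 then s ^ #T else 0 := by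
    intro ω
    split_ifs with h
    · rw [← prod_const]
      exact prod_congr rfl fun v hv => if_pos fun j => h (⟨v, hv⟩, j)
    · push Not at h
      obtain ⟨⟨v, j⟩, hvj⟩ := h
      exact prod_eq_zero v.2 (if_neg fun h' => hvj (h' j))
  simp only [h1]
  rw [← Finset.sum_filter, sum_const, nsmul_eq_mul, prod_const, div_pow, ← mul_div_assoc,
    le_div_iff₀ (by positivity), mul_right_comm]
  refine mul_le_mul_of_nonneg_right ?_ (by positivity)
  have h2 := card_prescribed_mul_le (q := q) (fun p : T × J => ρ p.1 p.2) (by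
    rintro ⟨u, i⟩ ⟨v, j⟩ h
    by_cases huv : u = v
    · subst huv; rw [show i = j from hinj _ h]
    · exact absurd h (hdisj u (hT u.2) v (hT v.2) (fun h' => huv (Subtype.ext h')) i j))
    (fun p => x p.2)
  rw [Fintype.card_prod, Fintype.card_coe, mul_comm #T, pow_mul] at h2
  exact_mod_cast h2

lemma exists_balanced_coloring [Fintype V] [DecidableEq V] (hq : 0 < q) (ρ : V → J → X)
    (hinj : ∀ v, Function.Injective (ρ v)) {K : ℕ} (hK : 0 < K) (κ : V → Fin K)
    (hκ : ∀ u v, u ≠ v → κ u = κ v → ∀ i j, ρ u i ≠ ρ v j) :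
    ∃ ω : X → Fin q, ∀ x : J → Fin q, (#{v | ∀ j, ω (ρ v j) = x j} : ℝ) ≤
      (Real.exp 1 - 1) * (Fintype.card V / (q : ℝ) ^ Fintype.card J) +
        K * (Fintype.card J * Real.log q) := by
  have hq' : (0 : ℝ) < q := by exact_mod_cast hq
  have hK' : (0 : ℝ) < K := by exact_mod_cast hK
  have hNe : Nonempty (Fin q) := ⟨⟨0, hq⟩⟩
  set s : ℝ := Real.exp 1 - 1 with hs_def
  have hs : 0 ≤ s := by have := Real.add_one_le_exp (1 : ℝ); linarith
  set p : ℝ := s / (q : ℝ) ^ Fintype.card J with hp_def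
  have hp : 0 ≤ p := by positivity
  let C : Fin K → Finset V := fun k => univ.filter fun v => κ v = k
  let cnt : (X → Fin q) → (J → Fin q) → Fin K → ℝ := fun ω x k =>
    #((C k).filter fun v => ∀ j, ω (ρ v j) = x j)
  let Z : (X → Fin q) → (J → Fin q) → Fin K → ℝ := fun ω x k =>
    Real.exp (cnt ω x k - #(C k) * p)
  have hZ : ∀ x k, ∑ ω, Z ω x k ≤ (q : ℝ) ^ Fintype.card X := by
    intro x k
    have h1 := sum_prod_one_add_le hq ρ (C k) hinj (fun u hu v hv huv =>
      hκ u v huv ((mem_filter.1 hu).2.trans (mem_filter.1 hv).2.symm)) x hs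
    have h2 : ∀ ω : X → Fin q, ∏ v ∈ C k, (1 + if ∀ j, ω (ρ v j) = x j then s else 0) =
        Real.exp (cnt ω x k) := by
      intro ω
      have hcnt : Real.exp (cnt ω x k) =
          Real.exp 1 ^ #((C k).filter fun v => ∀ j, ω (ρ v j) = x j) := by
        rw [← Real.exp_nat_mul, mul_one]
      rw [hcnt, ← prod_const,
        prod_filter (fun v => ∀ j, ω (ρ v j) = x j)]
      refine prod_congr rfl fun v _ => ?_
      split_ifs <;> simp [hs_def]
    have h3 : (1 + p) ^ #(C k) ≤ Real.exp (#(C k) * p) := by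
      rw [Real.exp_nat_mul]
      exact pow_le_pow_left₀ (by positivity) (by linarith [Real.add_one_le_exp p]) _
    simp only [h2] at h1
    simp only [Z, Real.exp_sub]
    rw [← Finset.sum_div, div_le_iff₀ (Real.exp_pos _)]
    exact h1.trans (mul_le_mul_of_nonneg_left h3 (by positivity))
  obtain ⟨ω, -, hω⟩ : ∃ ω ∈ (univ : Finset (X → Fin q)),
      ∑ x, ∑ k, Z ω x k ≤ (q : ℝ) ^ Fintype.card J * K := by
    refine Finset.exists_le_of_sum_le univ_nonempty ?_
    calc ∑ ω, ∑ x, ∑ k, Z ω x k = ∑ x, ∑ k, ∑ ω, Z ω x k := by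
          rw [Finset.sum_comm]
          exact Finset.sum_congr rfl fun x _ => Finset.sum_comm
      _ ≤ ∑ x : J → Fin q, ∑ k : Fin K, (q : ℝ) ^ Fintype.card X :=
          Finset.sum_le_sum fun x _ => Finset.sum_le_sum fun k _ => hZ x k
      _ = ∑ ω : X → Fin q, (q : ℝ) ^ Fintype.card J * K := by
          simp; ring
  refine ⟨ω, fun x => ?_⟩
  have hx : ∑ k, Z ω x k ≤ (q : ℝ) ^ Fintype.card J * K :=
    le_trans (Finset.single_le_sum (f := fun x => ∑ k, Z ω x k)
      (fun x _ => Finset.sum_nonneg fun k _ => (Real.exp_pos _).le) (mem_univ x)) hω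
  have hjensen := convexOn_exp.map_sum_le (t := (univ : Finset (Fin K)))
    (w := fun _ => (K : ℝ)⁻¹) (p := fun k => cnt ω x k - #(C k) * p)
    (fun _ _ => by positivity) (by simp [hK'.ne']) (fun _ _ => Set.mem_univ _)
  simp only [smul_eq_mul, ← Finset.mul_sum] at hjensen
  have h4 : Real.exp ((K : ℝ)⁻¹ * ∑ k, (cnt ω x k - #(C k) * p)) ≤
      (q : ℝ) ^ Fintype.card J := by
    refine hjensen.trans ?_
    rw [inv_mul_le_iff₀ hK', mul_comm]
    exact hx
  rw [← Real.le_log_iff_exp_le (by positivity), Real.log_pow, inv_mul_le_iff₀ hK',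
    Finset.sum_sub_distrib, ← Finset.sum_mul] at h4
  have h5 : ∑ k, cnt ω x k = #{v | ∀ j, ω (ρ v j) = x j} := by
    simp only [cnt]
    rw [← Nat.cast_sum, card_eq_sum_card_fiberwise (f := κ) (t := univ)
      (fun _ _ => mem_coe.2 (mem_univ _))]
    simp only [C, filter_filter, and_comm]
  have h6 : ∑ k, (#(C k) : ℝ) = Fintype.card V := by
    rw [← Nat.cast_sum, ← card_univ, card_eq_sum_card_fiberwise (f := κ) (s := univ) (t := univ)
      (fun _ _ => mem_coe.2 (mem_univ _))]
  rw [h5, h6] at h4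
  have : s * (Fintype.card V / (q : ℝ) ^ Fintype.card J) = Fintype.card V * p := by
    rw [hp_def]; ring
  rw [this]
  linarith

end RandomColoring

section Conflicts

variable [Fintype V]

lemma card_neighborSet_le_maxDeg (G : SimpleGraph V) [DecidableRel G.Adj] (v : V) :
    #{w | G.Adj v w} ≤ maxDeg G := by
  have h : #{w | G.Adj v w} = deg G v := by
    unfold deg
    rw [Nat.card_eq_card_toFinset]
    congr 1
    ext w; simp
  rw [h]
  exact le_sup (f := deg G) (mem_univ v)

lemma exists_separating_coloring {K : ℕ} (N : V → Finset V)
    (hself : ∀ v, v ∈ N v) (hN : ∀ v, #(N v) ≤ K) (hK : 0 < K) :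
    ∃ κ : V → Fin K, ∀ u v, u ≠ v → κ u = κ v → ¬ (u ∈ N v ∧ v ∈ N u) := by
  classical
  suffices h : ∀ S : Finset V, ∃ κ : V → Fin K, ∀ u ∈ S, ∀ v ∈ S, u ≠ v → κ u = κ v →
      ¬ (u ∈ N v ∧ v ∈ N u) by
    obtain ⟨κ, hκ⟩ := h univ
    exact ⟨κ, fun u v => hκ u (mem_univ u) v (mem_univ v)⟩
  intro S
  induction S using Finset.induction_on with
  | empty => exact ⟨fun _ => ⟨0, hK⟩, by simp⟩
  | insert v S hv ih =>
    obtain ⟨κ, hκ⟩ := ih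
    have hlt : #(((N v).erase v).image κ) < #(univ : Finset (Fin K)) := by
      refine card_image_le.trans_lt ?_
      rw [card_erase_of_mem (hself v), card_univ, Fintype.card_fin]
      have := hN v
      omega
    obtain ⟨c, -, hc⟩ := exists_mem_notMem_of_card_lt_card hlt
    have hc' : ∀ w, w ≠ v → w ∈ N v → κ w ≠ c := fun w hw hwN h =>
      hc (mem_image.2 ⟨w, mem_erase.2 ⟨hw, hwN⟩, h⟩)
    refine ⟨Function.update κ v c, fun u hu w hw huw h => ?_⟩
    rcases mem_insert.1 hu with rfl | hu <;> rcases mem_insert.1 hw with rfl | hw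
    · exact absurd rfl huw
    · rw [Function.update_self, Function.update_of_ne huw.symm] at h
      exact fun h' => hc' w huw.symm h'.2 h.symm
    · rw [Function.update_self, Function.update_of_ne huw] at h
      exact fun h' => hc' u huw h'.1 h
    · have hu' : u ≠ v := fun e => hv (e ▸ hu)
      have hw' : w ≠ v := fun e => hv (e ▸ hw)
      rw [Function.update_of_ne hu', Function.update_of_ne hw'] at h
      exact hκ u hu w hw huw h

variable [DecidableEq V] (G : SimpleGraph V) [DecidableRel G.Adj]

/-- The ball of radius `d` around `v` in `G`. -/
def ball : ℕ → V → Finset V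
  | 0, v => {v}
  | d + 1, v => insert v ((univ.filter fun w => G.Adj v w).biUnion (ball d))

variable {G}

lemma mem_ball_self (d : ℕ) (v : V) : v ∈ ball G d v := by
  cases d <;> simp [ball]

lemma mem_ball_succ_of_mem {d : ℕ} {u v w : V} (h : v ∈ ball G d u) (hw : w = v ∨ G.Adj v w) :
    w ∈ ball G (d + 1) u := by
  induction d generalizing u with
  | zero =>
    simp only [ball, mem_singleton] at h
    subst h
    rcases hw with rfl | hw
    · exact mem_ball_self _ _
    · simp [ball, hw]
  | succ d ih =>
    rw [ball, mem_insert, mem_biUnion] at h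
    rcases h with rfl | ⟨x, hx, h⟩
    · rcases hw with rfl | hw
      · exact mem_ball_self _ _
      · rw [ball, mem_insert, mem_biUnion]
        exact Or.inr ⟨w, by simpa using hw, mem_ball_self _ _⟩
    · rw [ball, mem_insert, mem_biUnion]
      exact Or.inr ⟨x, hx, ih h⟩

lemma card_ball_le (hG : 0 < maxDeg G) (d : ℕ) (v : V) :
    #(ball G d v) ≤ 2 * maxDeg G ^ d := by
  rcases Nat.lt_or_ge 1 (maxDeg G) with h1 | h1
  · suffices #(ball G d v) + 1 ≤ 2 * maxDeg G ^ d by omega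
    induction d generalizing v with
    | zero => simp [ball]
    | succ d ih =>
      have h2 : #((univ.filter fun w => G.Adj v w).biUnion (ball G d)) ≤
          maxDeg G * (2 * maxDeg G ^ d - 1) := by
        refine (card_biUnion_le_card_mul _ _ _ fun w _ => ?_).trans
          (Nat.mul_le_mul_right _ (card_neighborSet_le_maxDeg G v))
        have := ih w
        omega
      have h3 := card_insert_le v ((univ.filter fun w => G.Adj v w).biUnion (ball G d))
      have h4 : 0 < maxDeg G ^ d := by positivity
      have h5 : maxDeg G * (2 * maxDeg G ^ d - 1) + maxDeg G = 2 * maxDeg G ^ (d + 1) := by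
        obtain ⟨m, hm⟩ : ∃ m, 2 * maxDeg G ^ d = m + 1 := ⟨2 * maxDeg G ^ d - 1, by omega⟩
        rw [pow_succ, ← mul_assoc, hm, Nat.add_sub_cancel]
        ring
      rw [ball]
      omega
  · have h2 : maxDeg G = 1 := by omega
    have hsub : ∀ d v, ball G d v ⊆ insert v (univ.filter fun w => G.Adj v w) := by
      intro d
      induction d with
      | zero => intro v; simp [ball]
      | succ d ih =>
        intro v
        refine insert_subset (mem_insert_self _ _) (biUnion_subset.2 fun w hw => ?_)
        refine (ih w).trans (insert_subset (mem_insert_of_mem hw) fun x hx => ?_)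
        have hle := card_neighborSet_le_maxDeg G w
        rw [h2, card_le_one] at hle
        rw [hle x hx v (by simpa [G.adj_comm] using hw)]
        exact mem_insert_self _ _
    have h3 := card_neighborSet_le_maxDeg G v
    have h4 := (card_le_card (hsub d v)).trans (card_insert_le _ _)
    rw [h2, one_pow]
    omega

lemma mem_ball_of_iterate_eq {f : V → V} (hf : ∀ v, f v = v ∨ G.Adj v (f v)) {u v : V}
    {k l : ℕ} (h : f^[k] u = f^[l] v) : v ∈ ball G (k + l) u := by
  have h1 : ∀ k, f^[k] u ∈ ball G k u := by
    intro k
    induction k with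
    | zero => exact mem_ball_self _ _
    | succ k ih =>
      rw [Function.iterate_succ_apply']
      exact mem_ball_succ_of_mem ih (hf _)
  have h2 : ∀ j ≤ l, f^[l - j] v ∈ ball G (k + j) u := by
    intro j hj
    induction j with
    | zero => simpa [← h] using h1 k
    | succ j ih =>
      refine mem_ball_succ_of_mem (ih (by omega)) ?_
      rw [show l - j = (l - (j + 1)) + 1 by omega, Function.iterate_succ_apply']
      rcases hf (f^[l - (j + 1)] v) with h' | h'
      · exact Or.inl h'.symm
      · exact Or.inr h'.symm
  simpa using h2 l le_rfl

lemma ball_mono {d e : ℕ} (h : d ≤ e) (u : V) : ball G d u ⊆ ball G e u := by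
  induction e, h using Nat.le_induction with
  | base => exact subset_rfl
  | succ e _ ih => exact fun v hv => mem_ball_succ_of_mem (ih hv) (Or.inl rfl)

end Conflicts

section Contraction

variable [Fintype V] [DecidableEq V]

/-- The partition obtained from `P` by merging the parts `A` and `B`. -/
def mergeParts (P : Finpartition (univ : Finset V)) (A B : Finset V) (hA : A ∈ P.parts)
    (hB : B ∈ P.parts) : Finpartition (univ : Finset V) :=
  Finpartition.ofExistsUnique (insert (A ∪ B) ((P.parts.erase A).erase B))
    (fun _ _ => subset_univ _)
    (fun v _ => by
      by_cases hv : v ∈ A ∪ B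
      · refine ⟨A ∪ B, ⟨mem_insert_self _ _, hv⟩, fun C ⟨hC, hvC⟩ => ?_⟩
        rcases mem_insert.1 hC with rfl | hC
        · rfl
        · simp only [mem_erase] at hC
          rcases mem_union.1 hv with h | h
          · exact absurd (P.eq_of_mem_parts hC.2.2 hA hvC h) hC.2.1
          · exact absurd (P.eq_of_mem_parts hC.2.2 hB hvC h) hC.1
      · have hv' := not_or.1 (mem_union.not.1 hv)
        refine ⟨P.part v, ⟨mem_insert_of_mem (mem_erase.2 ⟨?_, mem_erase.2 ⟨?_, ?_⟩⟩), ?_⟩,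
          fun C ⟨hC, hvC⟩ => ?_⟩
        · rintro rfl; exact hv'.2 (P.mem_part_self.2 (mem_univ v))
        · rintro rfl; exact hv'.1 (P.mem_part_self.2 (mem_univ v))
        · exact P.part_mem.2 (mem_univ v)
        · exact P.mem_part_self.2 (mem_univ v)
        · rcases mem_insert.1 hC with rfl | hC
          · exact absurd hvC hv
          · exact (P.part_eq_of_mem (mem_of_mem_erase (mem_of_mem_erase hC)) hvC).symm)
    (fun h => by
      rcases mem_insert.1 h with h | h
      · exact P.ne_empty hA (union_eq_empty.1 h.symm).1
      · exact P.empty_notMem_parts (mem_of_mem_erase (mem_of_mem_erase h)))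

lemma parts_mergeParts (P : Finpartition (univ : Finset V)) {A B : Finset V} (hA : A ∈ P.parts)
    (hB : B ∈ P.parts) :
    (mergeParts P A B hA hB).parts = insert (A ∪ B) ((P.parts.erase A).erase B) := rfl

lemma exists_merge_chain {P Q : Finpartition (univ : Finset V)} (h : P ≤ Q) :
    Relation.ReflTransGen (fun R R' => IsMergeStep R R' ∧ P ≤ R' ∧ R' ≤ Q) P Q := by
  induction hn : #P.parts using Nat.strong_induction_on generalizing P with
  | _ n ih =>
    by_cases hQP : Q ≤ P
    · rw [le_antisymm h hQP]
    · obtain ⟨C, hC, hCP⟩ : ∃ C ∈ Q.parts, ∀ A ∈ P.parts, ¬ C ≤ A := by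
        by_contra hcon
        push Not at hcon
        exact hQP fun C hC => hcon C hC
      obtain ⟨x, hx⟩ := Q.nonempty_of_mem_parts hC
      have hsub : ∀ y ∈ C, P.part y ⊆ C := by
        intro y hy
        obtain ⟨C', hC', hle⟩ := h (P.part_mem.2 (mem_univ y))
        rwa [Q.eq_of_mem_parts hC hC' hy (hle (P.mem_part_self.2 (mem_univ y)))]
      obtain ⟨y, hy, hyx⟩ := Set.not_subset.1 (fun h' : (C : Set V) ⊆ P.part x =>
        hCP _ (P.part_mem.2 (mem_univ x)) (coe_subset.1 h'))
      have hA := P.part_mem.2 (mem_univ x)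
      have hB := P.part_mem.2 (mem_univ y)
      have hne : P.part x ≠ P.part y := fun he =>
        hyx (mem_coe.2 (he ▸ P.mem_part_self.2 (mem_univ y)))
      have hPP : P ≤ mergeParts P _ _ hA hB := by
        intro D hD
        rw [parts_mergeParts]
        by_cases hDA : D = P.part x
        · exact ⟨_, mem_insert_self _ _, hDA ▸ subset_union_left⟩
        by_cases hDB : D = P.part y
        · exact ⟨_, mem_insert_self _ _, hDB ▸ subset_union_right⟩
        exact ⟨D, mem_insert_of_mem (mem_erase.2 ⟨hDB, mem_erase.2 ⟨hDA, hD⟩⟩), le_rfl⟩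
      have hPQ : mergeParts P _ _ hA hB ≤ Q := by
        intro D hD
        rw [parts_mergeParts] at hD
        rcases mem_insert.1 hD with rfl | hD
        · exact ⟨C, hC, union_subset (hsub x hx) (hsub y hy)⟩
        · exact h (mem_of_mem_erase (mem_of_mem_erase hD))
      have hcard : #(mergeParts P _ _ hA hB).parts < n := by
        rw [parts_mergeParts, ← hn]
        have h1 := card_erase_lt_of_mem hA
        have h2 := card_erase_lt_of_mem (mem_erase.2 ⟨hne.symm, hB⟩)
        have h3 := card_insert_le (P.part x ∪ P.part y) ((P.parts.erase (P.part x)).erase (P.part y))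
        omega
      refine Relation.ReflTransGen.head ⟨⟨_, hA, _, hB, hne, rfl⟩, hPP, hPQ⟩ ?_
      exact Relation.ReflTransGen.mono (fun R R' hR => ⟨hR.1, hPP.trans hR.2.1, hR.2.2⟩) _ _
        (ih _ hcard hPQ rfl)

lemma exists_seq_of_reflTransGen {α : Type*} {r : α → α → Prop} {x y : α}
    (h : Relation.ReflTransGen r x y) :
    ∃ n : ℕ, ∃ p : ℕ → α, p 0 = x ∧ p n = y ∧ ∀ i < n, r (p i) (p (i + 1)) := by
  induction h using Relation.ReflTransGen.head_induction_on with
  | refl => exact ⟨0, fun _ => y, rfl, rfl, by simp⟩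
  | head h _ ih =>
    rename_i a c _
    obtain ⟨n, p, h0, hn, hp⟩ := ih
    refine ⟨n + 1, fun i => Nat.casesOn i a p, rfl, hn, fun i hi => ?_⟩
    cases i with
    | zero => simpa [h0] using h
    | succ i => exact hp i (by omega)

lemma stww_le_of_chain (G : SimpleGraph V) {w : ℕ} {Q : Finpartition (univ : Finset V)}
    (hQ : #Q.parts ≤ 1)
    (hbot : ∀ A ∈ (⊥ : Finpartition (univ : Finset V)).parts, quotDeg G ⊥ A ≤ w)
    (h : Relation.ReflTransGen
      (fun R R' => IsMergeStep R R' ∧ ∀ A ∈ R'.parts, quotDeg G R' A ≤ w) ⊥ Q) :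
    stww G ≤ w := by
  obtain ⟨n, p, h0, hn, hp⟩ := exists_seq_of_reflTransGen h
  refine Nat.sInf_le ⟨n, fun i => p i, ?_, ?_, fun i => (hp i i.2).1, fun i => ?_⟩
  · intro A hA
    simp only [Fin.val_zero, h0, Finpartition.mem_bot_iff] at hA
    obtain ⟨v, -, rfl⟩ := hA
    exact card_singleton v
  · simpa [hn] using hQ
  · obtain ⟨i, hi⟩ := i
    cases i with
    | zero => simpa only [h0] using hbot
    | succ i => exact (hp i (by omega)).2

lemma quotDeg_le_card {γ : Type*} (G : SimpleGraph V) (P : Finpartition (univ : Finset V))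
    (L : V → γ) (hL : ∀ B ∈ P.parts, ∀ v v', L v = L v' → v ∈ B → v' ∈ B) {A : Finset V}
    (T : Finset γ) (hT : ∀ u ∈ A, ∀ v, G.Adj u v → L v ∈ T) : quotDeg G P A ≤ #T := by
  unfold quotDeg
  rw [← Nat.card_eq_finsetCard]
  choose v hv using fun B : {B : Finset V // B ∈ P.parts ∧ B ≠ A ∧ ∃ u ∈ A, ∃ v ∈ B, G.Adj u v} =>
    show ∃ v ∈ B.1, ∃ u ∈ A, G.Adj u v by
      obtain ⟨B, -, -, u, hu, v, hv, huv⟩ := B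
      exact ⟨v, hv, u, hu, huv⟩
  refine Nat.card_le_card_of_injective (fun B => ⟨L (v B), ?_⟩) ?_
  · obtain ⟨-, u, hu, huv⟩ := hv B
    exact hT u hu _ huv
  · intro B B' h
    have h' : L (v B) = L (v B') := by simpa using h
    exact Subtype.ext (P.eq_of_mem_parts B.2.1 B'.2.1 (hL _ B.2.1 _ _ h' (hv B).1) (hv B').1)

lemma quotDeg_le_card_mul (G : SimpleGraph V) (P : Finpartition (univ : Finset V))
    (A : Finset V) : quotDeg G P A ≤ #A * maxDeg G := by
  classical
  refine (quotDeg_le_card G P id (by rintro B - v v' rfl h; exact h)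
    (A.biUnion fun u => univ.filter fun w => G.Adj u w) ?_).trans
    (card_biUnion_le_card_mul _ _ _ fun u _ => card_neighborSet_le_maxDeg G u)
  intro u hu v huv
  exact mem_biUnion.2 ⟨u, hu, by simpa using huv⟩

/-- The partition of `V` into the nonempty fibers of `L`. -/
def fibers {β : Type*} (L : V → β) : Finpartition (univ : Finset V) :=
  open Classical in Finpartition.ofSetoid (Setoid.ker L)

lemma mem_part_fibers {β : Type*} (L : V → β) {u v : V} :
    v ∈ (fibers L).part u ↔ L u = L v := by
  classical
  exact Finpartition.mem_part_ofSetoid_iff_rel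

lemma eq_of_le_fibers {β : Type*} {L : V → β} {R : Finpartition (univ : Finset V)}
    (h : R ≤ fibers L) {A : Finset V} (hA : A ∈ R.parts) {u v : V} (hu : u ∈ A) (hv : v ∈ A) :
    L u = L v := by
  obtain ⟨C, hC, hAC⟩ := h hA
  rw [← mem_part_fibers, (fibers L).part_eq_of_mem hC (hAC hu)]
  exact hAC hv

lemma mem_of_fibers_le {β : Type*} {L : V → β} {R : Finpartition (univ : Finset V)}
    (h : fibers L ≤ R) {B : Finset V} (hB : B ∈ R.parts) {u v : V} (huv : L u = L v)
    (hu : u ∈ B) : v ∈ B := by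
  obtain ⟨C, hC, hle⟩ := h ((fibers L).part_mem.2 (mem_univ u))
  rw [R.eq_of_mem_parts hB hC hu (hle ((fibers L).mem_part_self.2 (mem_univ u)))]
  exact hle ((mem_part_fibers L).2 huv)

lemma fibers_le_fibers {β β' : Type*} {L : V → β} {L' : V → β'}
    (h : ∀ u v, L u = L v → L' u = L' v) : fibers L ≤ fibers L' := by
  intro A hA
  obtain ⟨u, hu⟩ := (fibers L).nonempty_of_mem_parts hA
  refine ⟨_, (fibers L').part_mem.2 (mem_univ u), fun v hv => ?_⟩
  exact (mem_part_fibers L').2 (h u v (eq_of_le_fibers le_rfl hA hu hv))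

lemma card_parts_fibers_le_one {β : Type*} {L : V → β} (h : ∀ u v, L u = L v) :
    #(fibers L).parts ≤ 1 := by
  rw [card_le_one]
  intro A hA B hB
  obtain ⟨u, hu⟩ := (fibers L).nonempty_of_mem_parts hA
  obtain ⟨v, hv⟩ := (fibers L).nonempty_of_mem_parts hB
  exact (fibers L).eq_of_mem_parts hA hB (mem_of_fibers_le le_rfl hA (h u v) hu) hv

end Contraction

section Labels

variable {a q : ℕ}

/-- The label of `v`: in each coordinate `i`, the list of the first `ℓ i` colors of `v`. -/
def label (col : V → Fin a → ℕ → Fin q) (ℓ : Fin a → ℕ) (v : V) : Fin a → List (Fin q) :=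
  fun i => (List.range (ℓ i)).map (col v i)

/-- The tuples of lists of lengths `ℓ` which are close to `x` in at least `b` coordinates. -/
def nearLabels (b r : ℕ) (ℓ : Fin a → ℕ) (x : Fin a → List (Fin q)) :
    Finset (Fin a → List (Fin q)) :=
  (powersetCard b univ).biUnion fun I => Fintype.piFinset fun i =>
    if i ∈ I then closeLists r (x i)
    else (univ : Finset (Fin (ℓ i) → Fin q)).image fun g => List.ofFn g

lemma card_nearLabels_le {b r : ℕ} (hq : 0 < q) (hr : 0 < r) {ℓ : Fin a → ℕ} (hℓ : ∀ i, ℓ i ≤ r)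
    (x : Fin a → List (Fin q)) :
    #(nearLabels b r ℓ x) ≤ a ^ b * ((r ^ 2 * q) ^ b * (q ^ r) ^ (a - b)) := by
  refine (card_biUnion_le_card_mul _ _ ((r ^ 2 * q) ^ b * (q ^ r) ^ (a - b))
    fun I hI => ?_).trans (Nat.mul_le_mul_right _ ?_)
  · have hIb : #I = b := (mem_powersetCard.1 hI).2
    rw [Fintype.card_piFinset]
    calc _ ≤ ∏ i, if i ∈ I then r ^ 2 * q else q ^ r := prod_le_prod' fun i _ => by
          split_ifs
          · exact card_closeLists_le hq hr _
          · refine card_image_le.trans ?_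
            simpa using Nat.pow_le_pow_right hq (hℓ i)
      _ = (r ^ 2 * q) ^ b * (q ^ r) ^ (a - b) := by
          rw [prod_ite, prod_const, prod_const, filter_mem_eq_inter, univ_inter, hIb,
            filter_not, filter_mem_eq_inter, univ_inter, ← compl_eq_univ_sdiff, card_compl,
            Fintype.card_fin, hIb]
  · rw [card_powersetCard, card_univ, Fintype.card_fin]
    exact Nat.choose_le_pow a b

/-- The colorings `col` of all vertices by tuples of sequences are such that adjacent vertices
receive close sequences in at least `b` coordinates, for every truncation of the sequences. -/
def CloseOnEdges (G : SimpleGraph V) (b : ℕ) (col : V → Fin a → ℕ → Fin q) : Prop :=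
  ∀ u v, G.Adj u v → ∃ I : Finset (Fin a), #I = b ∧ ∀ i ∈ I, ∀ m, 0 < m →
    Close ((List.range m).map (col u i)) ((List.range m).map (col v i))

variable {G : SimpleGraph V} {b r : ℕ} {col : V → Fin a → ℕ → Fin q}

lemma CloseOnEdges.label_mem_nearLabels (h : CloseOnEdges G b col) {ℓ : Fin a → ℕ}
    (hℓ : ∀ i, ℓ i ≤ r) {u v : V} (huv : G.Adj u v) :
    label col ℓ v ∈ nearLabels b r ℓ (label col ℓ u) := by
  obtain ⟨I, hI, hclose⟩ := h u v huv
  refine mem_biUnion.2 ⟨I, mem_powersetCard.2 ⟨subset_univ _, hI⟩,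
    Fintype.mem_piFinset.2 fun i => ?_⟩
  split_ifs with hi
  · rcases Nat.eq_zero_or_pos (ℓ i) with h0 | h0
    · simp [label, h0, closeLists]
    · exact (hclose i hi _ h0).mem_closeLists (by simpa using hℓ i) (by simpa using hℓ i)
  · refine mem_image.2 ⟨fun k => col v i k, mem_univ _, ?_⟩
    refine List.ext_getElem (by simp [label]) fun k _ _ => ?_
    simp [label]

variable [Fintype V] [DecidableEq V]

lemma CloseOnEdges.quotDeg_le (h : CloseOnEdges G b col) (hq : 0 < q) (hr : 0 < r)
    {ℓ : Fin a → ℕ} {i₀ : Fin a} {k : ℕ} (hk : ℓ i₀ = k + 1) (hℓ : ∀ i, ℓ i ≤ r)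
    {R : Finpartition (univ : Finset V)} (hR : fibers (label col ℓ) ≤ R)
    (hR' : R ≤ fibers (label col (Function.update ℓ i₀ k))) {A : Finset V} (hA : A ∈ R.parts) :
    quotDeg G R A ≤ a ^ b * ((r ^ 2 * q) ^ b * (q ^ r) ^ (a - b)) * q := by
  classical
  set ℓ' := Function.update ℓ i₀ k with hℓ'
  have hle : ∀ i, ℓ' i ≤ r := by
    intro i
    have := hℓ i
    by_cases hi : i = i₀
    · subst hi; simp [hℓ']; omega
    · simpa [hℓ', hi] using this
  have hlabel : ∀ v, label col ℓ v = Function.update (label col ℓ' v) i₀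
      (label col ℓ' v i₀ ++ [col v i₀ k]) := by
    intro v
    funext i
    by_cases hi : i = i₀
    · subst hi; simp [label, hℓ', hk, List.range_succ]
    · simp [label, hℓ', hi]
  obtain ⟨u₀, hu₀⟩ := R.nonempty_of_mem_parts hA
  let T := (nearLabels b r ℓ' (label col ℓ' u₀) ×ˢ (univ : Finset (Fin q))).image
    fun p => Function.update p.1 i₀ (p.1 i₀ ++ [p.2])
  calc quotDeg G R A ≤ #T := quotDeg_le_card G R (label col ℓ)
        (fun B hB v v' hv hvB => mem_of_fibers_le hR hB hv hvB) T fun u hu v huv => by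
          refine mem_image.2 ⟨(label col ℓ' v, col v i₀ k),
            mem_product.2 ⟨?_, mem_univ _⟩, (hlabel v).symm⟩
          rw [eq_of_le_fibers hR' hA hu₀ hu]
          exact h.label_mem_nearLabels hle huv
    _ ≤ #(nearLabels b r ℓ' (label col ℓ' u₀)) * q := by
        refine card_image_le.trans ?_
        rw [card_product, card_univ, Fintype.card_fin]
    _ ≤ _ := Nat.mul_le_mul_right _ (card_nearLabels_le hq hr hle _)

lemma CloseOnEdges.exists_chain (h : CloseOnEdges G b col) (hq : 0 < q) (hr : 0 < r) {w : ℕ}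
    (hw : a ^ b * ((r ^ 2 * q) ^ b * (q ^ r) ^ (a - b)) * q ≤ w) (ℓ : Fin a → ℕ)
    (hℓ : ∀ i, ℓ i ≤ r) :
    Relation.ReflTransGen (fun R R' => IsMergeStep R R' ∧ ∀ A ∈ R'.parts, quotDeg G R' A ≤ w)
      (fibers (label col ℓ)) (fibers (label col fun _ => 0)) := by
  classical
  induction hn : ∑ i, ℓ i generalizing ℓ with
  | zero =>
    have : ℓ = fun _ => 0 := by
      funext i
      exact Finset.sum_eq_zero_iff.1 hn i (mem_univ i)
    rw [this]
  | succ n ih =>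
    obtain ⟨i₀, hi₀⟩ : ∃ i, ℓ i ≠ 0 := by
      by_contra! hcon
      simp [hcon] at hn
    obtain ⟨k, hk⟩ := Nat.exists_eq_succ_of_ne_zero hi₀
    have hle : ∀ i, Function.update ℓ i₀ k i ≤ ℓ i := by
      intro i
      by_cases hi : i = i₀
      · subst hi; simp; omega
      · simp [hi]
    have hsum : ∑ i, Function.update ℓ i₀ k i = n := by
      rw [Finset.sum_update_of_mem (mem_univ _)]
      rw [← Finset.add_sum_erase _ _ (mem_univ i₀), hk] at hn
      rw [← erase_eq]
      omega
    refine Relation.ReflTransGen.trans ?_ (ih _ (fun i => (hle i).trans (hℓ i)) hsum)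
    have hfib : fibers (label col ℓ) ≤ fibers (label col (Function.update ℓ i₀ k)) := by
      refine fibers_le_fibers fun u v huv => ?_
      funext i
      have := congrArg (List.take (Function.update ℓ i₀ k i)) (congrFun huv i)
      simpa [label, ← List.map_take, List.take_range, min_eq_left (hle i)] using this
    exact Relation.ReflTransGen.mono (fun R R' hR => ⟨hR.1, fun A hA =>
      (h.quotDeg_le hq hr hk hℓ hR.2.1 hR.2.2 hA).trans hw⟩) _ _ (exists_merge_chain hfib)

lemma CloseOnEdges.stww_le (h : CloseOnEdges G b col) (hq : 0 < q) (hr : 0 < r) {w m : ℕ}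
    (hw : a ^ b * ((r ^ 2 * q) ^ b * (q ^ r) ^ (a - b)) * q ≤ w)
    (hm : ∀ x : Fin a × Fin r → Fin q, #{v | ∀ j, col v j.1 j.2 = x j} ≤ m)
    (hmw : m * maxDeg G ≤ w) : stww G ≤ w := by
  have hgood : ∀ R ≤ fibers (label col fun _ => r), ∀ A ∈ R.parts, quotDeg G R A ≤ w := by
    intro R hR A hA
    refine (quotDeg_le_card_mul G R A).trans ((Nat.mul_le_mul_right _ ?_).trans hmw)
    obtain ⟨u, hu⟩ := R.nonempty_of_mem_parts hA
    refine (card_le_card fun v hv => ?_).trans (hm fun j => col u j.1 j.2)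
    rw [mem_filter]
    refine ⟨mem_univ _, fun j => ?_⟩
    have h1 := congrFun (eq_of_le_fibers hR hA hv hu) j.1
    have h2 := congrArg (fun L : List (Fin q) => L[(j.2 : ℕ)]?) h1
    simpa [label] using h2
  exact stww_le_of_chain G (card_parts_fibers_le_one (L := label col fun _ => 0) fun _ _ => rfl)
    (hgood ⊥ bot_le) (Relation.ReflTransGen.trans
      (Relation.ReflTransGen.mono (fun R R' hR => ⟨hR.1, hgood R' hR.2.2⟩) _ _
        (exists_merge_chain bot_le)) (h.exists_chain hq hr hw _ fun _ => le_rfl))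

end Labels

lemma stww_eq_zero_of_maxDeg_eq_zero [Fintype V] [DecidableEq V] (G : SimpleGraph V)
    (h : maxDeg G = 0) : stww G = 0 := by
  have hgood : ∀ (R : Finpartition (univ : Finset V)), ∀ A ∈ R.parts, quotDeg G R A ≤ 0 :=
    fun R A _ => by simpa [h] using quotDeg_le_card_mul G R A
  refine Nat.le_zero.1 (stww_le_of_chain G (card_parts_fibers_le_one (L := fun _ => ())
    fun _ _ => rfl) (hgood ⊥) ?_)
  exact Relation.ReflTransGen.mono (fun R R' hR => ⟨hR.1, hgood R'⟩) _ _
    (exists_merge_chain bot_le)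

lemma exists_closeOnEdges_coloring [Fintype V] [DecidableEq V] (G : SimpleGraph V)
    {a b q r : ℕ} (hq : 2 ≤ q) (hr : 0 < r) (hG : 0 < maxDeg G) (f : Fin a → V → V)
    (hf : ∀ c v, f c v = v ∨ G.Adj v (f c v))
    (hcov : ∀ u v, G.Adj u v → ∃ I : Finset (Fin a), #I = b ∧ ∀ c ∈ I, f c u = v ∨ f c v = u)
    (hv : 6 * r * a * q ^ (a * r + 1) * maxDeg G ^ (3 * r) ≤ Fintype.card V) :
    ∃ col : V → Fin a → ℕ → Fin q, CloseOnEdges G b col ∧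
      ∀ x : Fin a × Fin r → Fin q, (#{v | ∀ j, col v j.1 j.2 = x j} : ℝ) ≤
        3 * (Fintype.card V / (q : ℝ) ^ (a * r)) := by
  classical
  have : NeZero r := ⟨hr.ne'⟩
  have hK : 0 < 2 * maxDeg G ^ (2 * r) := by positivity
  obtain ⟨κ, hκ⟩ := exists_separating_coloring (ball G (2 * r)) (mem_ball_self _)
    (card_ball_le hG _) hK
  let ρ : V → Fin a × Fin r → Fin a × (V ⊕ (Set V × Fin r)) := fun v j =>
    (j.1, orbitSeq (f j.1) r v j.2)
  obtain ⟨ω, hω⟩ := exists_balanced_coloring (q := q) (by omega) ρ (by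
      rintro v ⟨c, k⟩ ⟨c', k'⟩ h
      simp only [ρ, Prod.mk.injEq] at h
      obtain ⟨rfl, h⟩ := h
      exact Prod.ext rfl (Fin.ext (orbitSeq_injOn k.2 k'.2 h))) hK κ (by
      rintro u v huv hκuv ⟨c, k⟩ ⟨c', k'⟩ h
      simp only [ρ, Prod.mk.injEq] at h
      obtain ⟨rfl, h⟩ := h
      obtain ⟨i, hi, j, hj, hij⟩ := exists_iterate_eq_of_orbitSeq_eq k.2 k'.2 h
      exact hκ u v huv hκuv
        ⟨ball_mono (by omega) _ (mem_ball_of_iterate_eq (hf c) hij.symm),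
          ball_mono (by omega) _ (mem_ball_of_iterate_eq (hf c) hij)⟩)
  refine ⟨fun v c k => ω (c, orbitSeq (f c) r v k), fun u v huv => ?_, fun x => ?_⟩
  · obtain ⟨I, hI, hIf⟩ := hcov u v huv
    refine ⟨I, hI, fun c hc m hm => ?_⟩
    rcases hIf c hc with h | h
    · have := close_map_orbitSeq (f c) u (fun z => ω (c, z)) hm
      rwa [h] at this
    · have := close_map_orbitSeq (f c) v (fun z => ω (c, z)) hm
      rw [h] at this
      exact this.symm
  · refine (hω x).trans ?_
    have hq' : (0 : ℝ) < q := by exact_mod_cast (by omega : 0 < q)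
    have hlog : Real.log q ≤ q := (Real.log_le_sub_one_of_pos hq').trans (by linarith)
    have hpow : ((2 * maxDeg G ^ (2 * r) : ℕ) : ℝ) ≤ 2 * (maxDeg G : ℝ) ^ (3 * r) := by
      push_cast
      have : (1 : ℝ) ≤ maxDeg G := by exact_mod_cast hG
      gcongr
      norm_num
    have he : Real.exp 1 - 1 ≤ 2 := by linarith [Real.exp_one_lt_d9]
    have hcard : Fintype.card (Fin a × Fin r) = a * r := by simp
    rw [hcard]
    set p := (Fintype.card V : ℝ) / (q : ℝ) ^ (a * r) with hp
    have hp0 : 0 ≤ p := by positivity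
    have hv' : 6 * (r * a * q * (maxDeg G : ℝ) ^ (3 * r)) ≤ p := by
      rw [hp, le_div_iff₀ (by positivity)]
      have : (6 * r * a * q ^ (a * r + 1) * maxDeg G ^ (3 * r) : ℝ) ≤ Fintype.card V := by
        exact_mod_cast hv
      refine le_of_eq_of_le ?_ this
      ring
    have h1 : ((2 * maxDeg G ^ (2 * r) : ℕ) : ℝ) * (((a * r : ℕ) : ℝ) * Real.log q) ≤
        2 * (maxDeg G : ℝ) ^ (3 * r) * (((a * r : ℕ) : ℝ) * q) := by
      gcongr
    have h2 : 2 * (maxDeg G : ℝ) ^ (3 * r) * (((a * r : ℕ) : ℝ) * q) =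
        2 * (r * a * q * (maxDeg G : ℝ) ^ (3 * r)) := by push_cast; ring
    have h3 : (Real.exp 1 - 1) * p ≤ 2 * p := by gcongr
    linarith

theorem statement_17 {V : Type*} [Fintype V] [DecidableEq V] (G : SimpleGraph V)
    (a b q r : ℕ) (hb : 0 < b) (hba : b ≤ a) (hq : 2 ≤ q) (hr : 0 < r)
    (hmad : mad G / 2 ≤ (a : ℝ) / b)
    (hv : 6 * r * a * q ^ (a * r + 1) * maxDeg G ^ (3 * r) ≤ Fintype.card V) :
    (stww G : ℝ) ≤ max ((r ^ (2 * b) * a ^ b * q ^ (a * r - b * (r - 1) + 1) : ℕ) : ℝ)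
      (3 / (q : ℝ) ^ (a * r) * Fintype.card V * maxDeg G) := by
  have hq0 : 0 < q := by omega
  have hq' : (0 : ℝ) < q := by exact_mod_cast hq0
  rcases Nat.eq_zero_or_pos (maxDeg G) with hG | hG
  · rw [stww_eq_zero_of_maxDeg_eq_zero G hG, Nat.cast_zero]
    exact le_max_of_le_left (Nat.cast_nonneg _)
  obtain ⟨f, hf, hcov⟩ := exists_covering_functions G hb hba hmad
  obtain ⟨col, hcol, hbal⟩ := exists_closeOnEdges_coloring G hq hr hG f hf hcov hv
  set B : ℕ := r ^ (2 * b) * a ^ b * q ^ (a * r - b * (r - 1) + 1) with hB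
  have hBeq : a ^ b * ((r ^ 2 * q) ^ b * (q ^ r) ^ (a - b)) * q = B := by
    obtain ⟨d, rfl⟩ := Nat.exists_eq_add_of_le hba
    have h1 : (b + d) * r - b * (r - 1) = b + d * r := by
      obtain ⟨s, rfl⟩ := Nat.exists_eq_add_of_le' hr
      rw [Nat.add_sub_cancel, Nat.sub_eq_iff_eq_add (by nlinarith)]
      ring
    rw [hB, h1, Nat.add_sub_cancel_left]
    ring
  have hM : 0 ≤ max (B : ℝ) (3 / (q : ℝ) ^ (a * r) * Fintype.card V * maxDeg G) :=
    le_max_of_le_left (Nat.cast_nonneg _)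
  refine le_trans (Nat.cast_le.2 (hcol.stww_le hq0 hr
    (w := ⌊max (B : ℝ) (3 / (q : ℝ) ^ (a * r) * Fintype.card V * maxDeg G)⌋₊)
    (m := ⌊3 * (Fintype.card V / (q : ℝ) ^ (a * r))⌋₊) ?_
    (fun x => Nat.le_floor (hbal x)) ?_)) (Nat.floor_le hM)
  · rw [hBeq]
    exact Nat.le_floor (le_max_left _ _)
  · refine Nat.le_floor (le_trans ?_ (le_max_right _ _))
    have h2 : (⌊3 * (Fintype.card V / (q : ℝ) ^ (a * r))⌋₊ : ℝ) ≤
        3 * (Fintype.card V / (q : ℝ) ^ (a * r)) := Nat.floor_le (by positivity)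
    push_cast
    calc _ ≤ 3 * (Fintype.card V / (q : ℝ) ^ (a * r)) * (maxDeg G : ℝ) := by gcongr
      _ = _ := by ring

end TwwPaper
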